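/- Assume the Continuum Hypothesis (2^{ℵ₀} = ℵ₁). Then there exist subsets A and B of ℕ^ℕ such that for every strictly increasing h ∈ ℕ^ℕ, neither maxfin(A ∘ h) nor maxfin(B ∘ h) is dominating, but maxfin(A ∪ B) is dominating. -/

import Mathlib

open Filter

/-- `f ≤* g`: `f n ≤ g n` for all but finitely many `n`. -/
def EvLE (f g : ℕ → ℕ) : Prop := ∀ᶠ n in atTop, f n ≤ g n

/-- A subset of the Baire space is dominating if every function is
eventually dominated by a member of it. -/
def Dominating (Y : Set (ℕ → ℕ)) : Prop := ∀ g : ℕ → ℕ, ∃ f ∈ Y, EvLE g f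

/-- A subset of the Baire space is bounded (w.r.t. `≤*`) if some single
function eventually dominates all its members. -/
def BoundedStar (Y : Set (ℕ → ℕ)) : Prop := ∃ g : ℕ → ℕ, ∀ f ∈ Y, EvLE f g

/-- `maxfin Y`: pointwise maxima of nonempty finite subsets of `Y`. -/
def maxfin (Y : Set (ℕ → ℕ)) : Set (ℕ → ℕ) :=
  {g | ∃ F : Finset (ℕ → ℕ), F.Nonempty ∧ ↑F ⊆ Y ∧ g = fun n => F.sup (fun f => f n)}

/-- `Y` is `k`-dominating: for each `f` there are `g_1, …, g_k ∈ Y` whose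
pointwise maximum eventually dominates `f`. -/
def KDominating (Y : Set (ℕ → ℕ)) (k : ℕ) : Prop :=
  ∀ f : ℕ → ℕ, ∃ g : Fin k → (ℕ → ℕ), (∀ i, g i ∈ Y) ∧
    ∀ᶠ n in atTop, f n ≤ Finset.univ.sup (fun i => g i n)

/-- An open cover of a topological space. -/
def IsOpenCover {α : Type*} [TopologicalSpace α] (𝒰 : Set (Set α)) : Prop :=
  (∀ u ∈ 𝒰, IsOpen u) ∧ ⋃₀ 𝒰 = Set.univ

/-- An ω-cover: a cover such that every finite subset of the space is
contained in some member. -/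
def IsOmegaCover {α : Type*} (𝒱 : Set (Set α)) : Prop :=
  ⋃₀ 𝒱 = Set.univ ∧ ∀ F : Set α, F.Finite → ∃ V ∈ 𝒱, F ⊆ V

/-- A γ-cover: an infinite cover such that every point belongs to all but
finitely many members. -/
def IsGammaCover {α : Type*} (𝒱 : Set (Set α)) : Prop :=
  ⋃₀ 𝒱 = Set.univ ∧ 𝒱.Infinite ∧ ∀ x : α, {V ∈ 𝒱 | x ∉ V}.Finite

/-- A set of reals is zero-dimensional: its subspace topology has a base of
clopen sets. -/
def ZeroDimensionalSet (X : Set ℝ) : Prop :=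
  ∃ B : Set (Set ↥X), TopologicalSpace.IsTopologicalBasis B ∧ ∀ b ∈ B, IsClopen b

/-- The Menger property `Ufin(O,O)`. -/
def MengerProp (α : Type*) [TopologicalSpace α] : Prop :=
  ∀ 𝒰 : ℕ → Set (Set α), (∀ n, (𝒰 n).Countable ∧ IsOpenCover (𝒰 n)) →
    ∃ ℱ : ℕ → Set (Set α), (∀ n, (ℱ n).Finite ∧ ℱ n ⊆ 𝒰 n) ∧
      (⋃ n, ⋃₀ ℱ n) = Set.univ

/-- The Hurewicz property `Ufin(O,Γ)`. -/
def HurewiczProp (α : Type*) [TopologicalSpace α] : Prop :=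
  ∀ 𝒰 : ℕ → Set (Set α), (∀ n, (𝒰 n).Countable ∧ IsOpenCover (𝒰 n)) →
    ∃ ℱ : ℕ → Set (Set α), (∀ n, (ℱ n).Finite ∧ ℱ n ⊆ 𝒰 n) ∧
      ((∃ n, ⋃₀ ℱ n = Set.univ) ∨ IsGammaCover {s | ∃ n, s = ⋃₀ ℱ n})

/-- The property `Ufin(O,Ω)`. -/
def UfinOOmega (α : Type*) [TopologicalSpace α] : Prop :=
  ∀ 𝒰 : ℕ → Set (Set α), (∀ n, (𝒰 n).Countable ∧ IsOpenCover (𝒰 n)) →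
    ∃ ℱ : ℕ → Set (Set α), (∀ n, (ℱ n).Finite ∧ ℱ n ⊆ 𝒰 n) ∧
      ((∃ n, ⋃₀ ℱ n = Set.univ) ∨ IsOmegaCover {s | ∃ n, s = ⋃₀ ℱ n})

theorem splitSeq (C : ℕ → Set ℕ) (hC : ∀ n, (C n).Infinite) :
    ∃ S : Set ℕ, ∀ n, (C n ∩ S).Infinite ∧ (C n \ S).Infinite := by
  have step : ∀ n m : ℕ, ∃ k ∈ C n, m < k := fun n m => (hC n).exists_gt m
  choose nx hnx hlt using step
  let e : ℕ → ℕ := fun k => (Nat.unpair (k / 2)).1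
  let m : ℕ → ℕ := fun k => Nat.rec (nx (e 0) 0) (fun j v => nx (e (j + 1)) v) k
  have hm : StrictMono m := strictMono_nat_of_lt_succ (fun k => hlt _ _)
  have hmC : ∀ k, m k ∈ C (e k) := by
    intro k
    cases k with
    | zero => exact hnx _ _
    | succ j => exact hnx _ _
  clear_value m
  have hp : ∀ n : ℕ, Function.Injective (Nat.pair n) := by
    intro n a b hab
    exact (Nat.pair_eq_pair.1 hab).2
  refine ⟨{v | ∃ k, v = m (2 * k)}, fun n => ⟨?_, ?_⟩⟩
  · refine (Set.infinite_range_of_injective (f := fun j => m (2 * Nat.pair n j)) ?_).mono ?_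
    · intro a b hab
      have := hm.injective (show m _ = m _ from hab)
      exact hp n (by omega)
    · rintro _ ⟨j, rfl⟩
      refine ⟨?_, _, rfl⟩
      have := hmC (2 * Nat.pair n j)
      simpa [e] using this
  · refine (Set.infinite_range_of_injective (f := fun j => m (2 * Nat.pair n j + 1)) ?_).mono ?_
    · intro a b hab
      have := hm.injective (show m (2 * Nat.pair n a + 1) = m (2 * Nat.pair n b + 1) from hab)
      exact hp n (by omega)
    · rintro _ ⟨j, rfl⟩
      refine ⟨?_, ?_⟩
      · have := hmC (2 * Nat.pair n j + 1)
        have h2 : (2 * Nat.pair n j + 1) / 2 = Nat.pair n j := by omega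
        simpa [e, h2] using this
      · rintro ⟨k, hk⟩
        have := hm.injective (show m (2 * Nat.pair n j + 1) = m (2 * k) from hk)
        omega

theorem splitFam {ι : Type*} [Countable ι] (C : ι → Set ℕ) :
    ∃ S : Set ℕ, ∀ i, (C i).Infinite → (C i ∩ S).Infinite ∧ (C i \ S).Infinite := by
  by_cases hne : Nonempty {i // (C i).Infinite}
  · obtain ⟨q, hq⟩ := exists_surjective_nat {i // (C i).Infinite}
    obtain ⟨S, hS⟩ := splitSeq (fun n => C (q n).1) (fun n => (q n).2)
    refine ⟨S, fun i hi => ?_⟩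
    obtain ⟨n, hn⟩ := hq ⟨i, hi⟩
    have := hS n
    rw [hn] at this
    exact this
  · exact ⟨∅, fun i hi => (hne ⟨⟨i, hi⟩⟩).elim⟩

theorem boundFam {ι : Type*} [Countable ι] (f : ι → ℕ → ℕ) :
    ∃ g : ℕ → ℕ, (∀ n, 0 < g n) ∧ ∀ i, ∀ᶠ n in atTop, f i n < g n := by
  by_cases hne : Nonempty ι
  · obtain ⟨q, hq⟩ := exists_surjective_nat ι
    refine ⟨fun n => (Finset.range (n + 1)).sup (fun j => f (q j) n) + 1,
      fun n => Nat.succ_pos _, fun i => ?_⟩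
    obtain ⟨j, rfl⟩ := hq i
    filter_upwards [eventually_ge_atTop j] with n hn
    exact Nat.lt_succ_of_le (Finset.le_sup (f := fun j => f (q j) n)
      (Finset.mem_range.2 (by omega)))
  · exact ⟨fun _ => 1, fun _ => Nat.one_pos, fun i => (hne ⟨i⟩).elim⟩

theorem notDom {I : Type*} [LinearOrder I] (hI : ∀ x : I, (Set.Iio x).Countable)
    (e : I → ℕ → ℕ) (T : I → Set ℕ)
    (hT : ∀ x y, y < x → ∀ F : Finset I, (∀ z ∈ F, z < x) →
      (Set.range (e y) \ ⋃ z ∈ F, T z).Infinite →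
      ((Set.range (e y) \ ⋃ z ∈ F, T z) \ T x).Infinite)
    (y : I) (hy : StrictMono (e y)) :
    ¬ Dominating (maxfin ((fun f => f ∘ e y) '' Set.range (fun x => (T x).indicator (e x)))) := by
  classical
  have key : ∀ F : Finset I, (∀ z ∈ F, y < z) →
      (Set.range (e y) \ ⋃ z ∈ F, T z).Infinite := by
    intro F
    induction F using Finset.induction_on_max with
    | empty => intro _; simpa using Set.infinite_range_of_injective hy.injective
    | insert a s ha ih =>
      intro h
      have h1 := hT a y (h a (by simp)) s ha (ih fun z hz => h z (by simp [hz]))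
      refine h1.mono ?_
      rintro v ⟨⟨hv1, hv2⟩, hv3⟩
      refine ⟨hv1, ?_⟩
      simp only [Set.mem_iUnion, not_exists, Finset.mem_insert] at hv2 ⊢
      rintro z (rfl | hz)
      · exact hv3
      · exact hv2 z hz
  intro hD
  have : Countable (Set.Iic y) := by
    rw [Set.countable_coe_iff, ← Set.Iio_insert]
    exact (hI y).insert y
  obtain ⟨g, hg0, hg⟩ := boundFam (fun x : Set.Iic y => fun n => e x.1 (e y n))
  obtain ⟨_, ⟨G, -, hG, rfl⟩, hle⟩ := hD g
  have hG' : ∀ u : G, ∃ x : I, u.1 = (T x).indicator (e x) ∘ e y := by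
    rintro ⟨u, hu⟩
    obtain ⟨_, ⟨x, rfl⟩, hx⟩ := hG hu
    exact ⟨x, hx.symm⟩
  choose p hp using hG'
  let F := (Finset.univ.image p).filter (y < ·)
  have hinf := key F (by simp [F])
  have hall : ∀ᶠ n in atTop, ∀ u : G, p u ≤ y → e (p u) (e y n) < g n := by
    rw [eventually_all]
    intro u
    by_cases hu : p u ≤ y
    · filter_upwards [hg ⟨p u, hu⟩] with n hn _ using hn
    · exact Eventually.of_forall fun n h => (hu h).elim
  obtain ⟨N, hN⟩ := eventually_atTop.1 (hle.and hall)
  obtain ⟨_, ⟨⟨n, rfl⟩, hn⟩, hnN⟩ := hinf.exists_notMem_finite ((Set.finite_Iio N).image (e y))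
  have hNn : N ≤ n := by
    by_contra hlt
    exact hnN ⟨n, by simpa using hlt, rfl⟩
  obtain ⟨h1, h2⟩ := hN n hNn
  refine absurd h1 (not_le.2 ?_)
  rw [Finset.sup_lt_iff (by simpa using hg0 n)]
  intro u hu
  have hpu := hp ⟨u, hu⟩
  simp only at hpu
  rw [hpu]
  by_cases hc : p ⟨u, hu⟩ ≤ y
  · exact lt_of_le_of_lt (Set.indicator_le_self _ _ _) (h2 ⟨u, hu⟩ hc)
  · have hnot : e y n ∉ T (p ⟨u, hu⟩) := by
      intro hmem
      apply hn
      simp only [Set.mem_iUnion]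
      exact ⟨p ⟨u, hu⟩, Finset.mem_filter.2 ⟨Finset.mem_image_of_mem p (Finset.mem_univ _), not_le.1 hc⟩, hmem⟩
    rw [Function.comp_apply, Set.indicator_of_notMem hnot]
    exact hg0 n

theorem existsS {I : Type*} [LinearOrder I] [WellFoundedLT I]
    (hI : ∀ x : I, (Set.Iio x).Countable) (e : I → ℕ → ℕ) :
    ∃ S : I → Set ℕ, ∀ x y, y < x → ∀ F : Finset I, (∀ z ∈ F, z < x) →
      ((Set.range (e y) \ ⋃ z ∈ F, S z).Infinite →
        ((Set.range (e y) \ ⋃ z ∈ F, S z) \ S x).Infinite) ∧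
      ((Set.range (e y) \ ⋃ z ∈ F, (S z)ᶜ).Infinite →
        ((Set.range (e y) \ ⋃ z ∈ F, (S z)ᶜ) \ (S x)ᶜ).Infinite) := by
  classical
  have hex : ∀ (x : I) (R : ∀ z, z < x → Set ℕ), ∃ S : Set ℕ,
      ∀ i : Set.Iio x × Finset (Set.Iio x),
      ((Set.range (e i.1) \ ⋃ z ∈ i.2, R z.1 z.2).Infinite →
        ((Set.range (e i.1) \ ⋃ z ∈ i.2, R z.1 z.2) \ S).Infinite) ∧
      ((Set.range (e i.1) \ ⋃ z ∈ i.2, (R z.1 z.2)ᶜ).Infinite →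
        ((Set.range (e i.1) \ ⋃ z ∈ i.2, (R z.1 z.2)ᶜ) \ Sᶜ).Infinite) := by
    intro x R
    have : Countable (Set.Iio x) := (hI x).to_subtype
    let J := Set.Iio x × Finset (Set.Iio x)
    let c1 : J → Set ℕ := fun i => Set.range (e i.1) \ ⋃ z ∈ i.2, R z.1 z.2
    let c2 : J → Set ℕ := fun i => Set.range (e i.1) \ ⋃ z ∈ i.2, (R z.1 z.2)ᶜ
    obtain ⟨S, hS⟩ := splitFam (Sum.elim c1 c2)
    refine ⟨S, fun i => ⟨fun h => (hS (Sum.inl i) h).2, fun h => ?_⟩⟩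
    have := (hS (Sum.inr i) h).1
    rw [Set.sdiff_compl]
    exact this
  choose Φ hΦ using hex
  let S : I → Set ℕ := (wellFounded_lt (α := I)).fix Φ
  have hS : ∀ x, S x = Φ x (fun z _ => S z) := fun x => WellFounded.fix_eq _ _ _
  refine ⟨S, fun x y hyx F hF => ?_⟩
  have h := hΦ x (fun z _ => S z) (⟨y, hyx⟩, F.subtype (· ∈ Set.Iio x))
  rw [← hS x] at h
  have e1 : ∀ U : I → Set ℕ,
      (⋃ z ∈ F.subtype (· ∈ Set.Iio x), U z.1) = ⋃ z ∈ F, U z := by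
    intro U
    ext v
    simp only [Set.mem_iUnion, Finset.mem_subtype]
    constructor
    · rintro ⟨z, hz, hv⟩
      exact ⟨z.1, hz, hv⟩
    · rintro ⟨z, hz, hv⟩
      exact ⟨⟨z, hF z hz⟩, hz, hv⟩
  have e2 := e1 S
  have e3 := e1 (fun z => (S z)ᶜ)
  simp only at h e3
  rw [e2, e3] at h
  exact h

/-- (Gitik) Assuming CH, there are `A, B ⊆ ℕ^ℕ` such that for every strictly
increasing `h ∈ ℕ^ℕ` neither `maxfin (A ∘ h)` nor `maxfin (B ∘ h)` is
dominating, yet `maxfin (A ∪ B)` is dominating. -/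
theorem exists_maxfin_comp_not_dominating_union_dominating
    (CH : Cardinal.continuum = Cardinal.aleph 1) :
    ∃ A B : Set (ℕ → ℕ),
      (∀ h : ℕ → ℕ, StrictMono h →
        ¬ Dominating (maxfin ((fun f => f ∘ h) '' A)) ∧
        ¬ Dominating (maxfin ((fun f => f ∘ h) '' B))) ∧
      Dominating (maxfin (A ∪ B)) := by
  classical
  have CH0 : Cardinal.continuum.{0} = Cardinal.aleph.{0} 1 := by
    have h := congrArg Cardinal.lift.{0} CH
    apply Cardinal.lift_injective
    simpa using h
  let I : Type := (Cardinal.aleph.{0} 1).ord.ToType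
  have hI : ∀ x : I, (Set.Iio x).Countable := by
    intro x
    have h : Cardinal.mk (Set.Iio x) < Order.succ Cardinal.aleph0 :=
      lt_of_lt_of_eq (Cardinal.mk_Iio_toType_ord_lt x) Cardinal.succ_aleph0.symm
    rw [← Cardinal.le_aleph0_iff_set_countable]
    exact Order.lt_succ_iff.1 h
  have hcard : Cardinal.mk I = Cardinal.mk (ℕ → ℕ) := by
    simp [I, CH0]
  obtain ⟨e⟩ := Cardinal.eq.1 hcard
  obtain ⟨S, hS⟩ := existsS hI e
  refine ⟨Set.range (fun x => (S x).indicator (e x)),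
    Set.range (fun x => ((S x)ᶜ).indicator (e x)), ?_, ?_⟩
  · intro h hh
    have hh' : StrictMono (e (e.symm h)) := by simpa using hh
    have h1 := notDom hI e S (fun x y hyx F hF => (hS x y hyx F hF).1) (e.symm h) hh'
    have h2 := notDom hI e (fun x => (S x)ᶜ)
      (fun x y hyx F hF => (hS x y hyx F hF).2) (e.symm h) hh'
    rw [e.apply_symm_apply] at h1 h2
    exact ⟨h1, h2⟩
  · intro g
    let x := e.symm g
    have hx : e x = g := e.apply_symm_apply g
    refine ⟨_, ⟨{(S x).indicator (e x), ((S x)ᶜ).indicator (e x)}, by simp, ?_, rfl⟩, ?_⟩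
    · intro u hu
      simp only [Finset.coe_insert, Finset.coe_singleton, Set.mem_insert_iff,
        Set.mem_singleton_iff] at hu
      rcases hu with rfl | rfl
      · exact Or.inl ⟨x, rfl⟩
      · exact Or.inr ⟨x, rfl⟩
    · refine Eventually.of_forall fun n => ?_
      rw [hx]
      by_cases hn : n ∈ S x
      · simp [hn]
      · simp [hn]
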